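/- Let {(~μ_t, μ_t) : t ≥ 0} be a two-state free convolution semigroup with relative canonical triple (~β, ~γ, ~ρ), ~γ > 0. Then for every t ≥ 0, ~μ_t = δ_{~βt} ⊎ Φ[~ρ ▷ μ_t]^{⊎~γt}; explicitly, z − F_{~μ_t}(z) = ~β t + ~γ t·G_{~ρ}(F_{μ_t}(z)) on ℂ⁺. In particular, for t > 0, J[~μ_t] = ~ρ ▷ μ_t. -/

import Mathlib

open MeasureTheory Complex

noncomputable section

/-- The Cauchy transform `G_μ(z) = ∫ 1/(z - x) dμ(x)` of a measure on `ℝ`. -/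
def cauchyG (μ : Measure ℝ) (z : ℂ) : ℂ := ∫ x : ℝ, (z - (x : ℂ))⁻¹ ∂μ

/-- The F-transform `F_μ = 1/G_μ`. -/
def Ftr (μ : Measure ℝ) (z : ℂ) : ℂ := (cauchyG μ z)⁻¹

/-- The open upper half-plane `ℂ⁺`. -/
def UHP : Set ℂ := {z : ℂ | 0 < z.im}

/-- The truncated cone `Γ_{α,M} = {z ∈ ℂ⁺ : |Re z| < α · Im z, Im z > M}`. -/
def tcone (α M : ℝ) : Set ℂ := {z : ℂ | |z.re| < α * z.im ∧ M < z.im}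

/-- `φ` is a Voiculescu transform of `μ`: `φ(F_μ(z)) + F_μ(z) = z` on some truncated cone. -/
def IsVT (μ : Measure ℝ) (φ : ℂ → ℂ) : Prop :=
  ∃ α M : ℝ, 0 < α ∧ 0 < M ∧ ∀ z ∈ tcone α M, φ (Ftr μ z) + Ftr μ z = z

/-- `ψ` is a two-state Voiculescu transform of the pair `(μt, μ)`:
`ψ(F_μ(z)) + F_{μt}(z) = z` on some truncated cone. -/
def IsTwoStateVT (μt μ : Measure ℝ) (ψ : ℂ → ℂ) : Prop :=
  ∃ α M : ℝ, 0 < α ∧ 0 < M ∧ ∀ z ∈ tcone α M, ψ (Ftr μ z) + Ftr μt z = z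

/-- `μ` is freely infinitely divisible: some Voiculescu transform `φ` of `μ` is such that
`t·φ` is a Voiculescu transform of a probability measure for every `t ≥ 0`. -/
def IsFID (μ : Measure ℝ) : Prop :=
  ∃ φ : ℂ → ℂ, IsVT μ φ ∧ ∀ t : ℝ, 0 ≤ t →
    ∃ ν : Measure ℝ, IsProbabilityMeasure ν ∧ IsVT ν (fun z => (t : ℂ) * φ z)

/-- The semicircular distribution with mean `β` and variance `γ` (Dirac mass at `β` for `γ = 0`). -/
def semicircle (β γ : ℝ) : Measure ℝ :=
  if γ = 0 then Measure.dirac β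
  else volume.withDensity
    (fun x => ENNReal.ofReal ((2 * Real.pi * γ)⁻¹ * Real.sqrt (4 * γ - (x - β) ^ 2)))

open Filter Topology Set Metric

theorem isOpen_UHP : IsOpen UHP := isOpen_lt continuous_const Complex.continuous_im

theorem convex_UHP : Convex ℝ UHP := convex_halfSpace_im_gt 0

theorem sub_ofReal_ne_zero {z : ℂ} (hz : 0 < z.im) (x : ℝ) : z - (x : ℂ) ≠ 0 := by
  intro h
  have := congrArg Complex.im h
  simp at this
  exact hz.ne' this

theorem im_le_norm_sub_ofReal (z : ℂ) (x : ℝ) : z.im ≤ ‖z - (x : ℂ)‖ := by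
  simpa using (le_abs_self _).trans (Complex.abs_im_le_norm (z - (x : ℂ)))

theorem differentiableOn_cauchyG (μ : Measure ℝ) [IsFiniteMeasure μ] :
    DifferentiableOn ℂ (cauchyG μ) UHP := by
  have h : cauchyG μ = -resolventTransform μ := by
    ext z
    simp only [cauchyG, Pi.neg_apply, resolventTransform_apply, resolvent, ← integral_neg]
    congr 1
    ext x
    rw [Ring.inverse_eq_inv, ← neg_sub, inv_neg]
    rfl
  rw [h]
  refine (analyticOn_resolventTransform.differentiableOn.mono ?_).neg
  rintro z hz ⟨x, -, rfl⟩
  simp [UHP] at hz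

theorem integrable_cauchy_kernel (μ : Measure ℝ) [IsFiniteMeasure μ] {z : ℂ} (hz : 0 < z.im) :
    Integrable (fun x : ℝ => (z - (x : ℂ))⁻¹) μ := by
  refine Integrable.of_bound (C := z.im⁻¹) (by fun_prop) (Eventually.of_forall fun x => ?_)
  rw [norm_inv]
  exact inv_anti₀ hz (im_le_norm_sub_ofReal z x)

theorem im_cauchy_kernel (z : ℂ) (x : ℝ) :
    ((z - (x : ℂ))⁻¹).im = -(z.im / ‖z - (x : ℂ)‖ ^ 2) := by
  rw [Complex.inv_im, Complex.normSq_eq_norm_sq]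
  simp [neg_div]

theorem im_cauchyG (μ : Measure ℝ) [IsFiniteMeasure μ] {z : ℂ} (hz : 0 < z.im) :
    (cauchyG μ z).im = -∫ x : ℝ, z.im / ‖z - (x : ℂ)‖ ^ 2 ∂μ := by
  have h := integral_im (𝕜 := ℂ) (integrable_cauchy_kernel μ hz)
  simp only [RCLike.im_to_complex, im_cauchy_kernel] at h
  rw [cauchyG, ← h, integral_neg]

theorem im_cauchyG_neg (μ : Measure ℝ) [IsProbabilityMeasure μ] {z : ℂ} (hz : 0 < z.im) :
    (cauchyG μ z).im < 0 := by
  rw [im_cauchyG μ hz, neg_lt_zero]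
  have hpos : ∀ x : ℝ, 0 < z.im / ‖z - (x : ℂ)‖ ^ 2 := fun x =>
    div_pos hz (pow_pos (norm_pos_iff.2 (sub_ofReal_ne_zero hz x)) 2)
  refine (integral_pos_iff_support_of_nonneg (fun x => (hpos x).le) ?_).2 ?_
  · simpa only [RCLike.im_to_complex, im_cauchy_kernel, Pi.neg_def, neg_neg] using
      (integrable_cauchy_kernel μ hz).im.neg
  · rw [Function.support_eq_univ fun x => (hpos x).ne']
    simp

theorem cauchyG_ne_zero (μ : Measure ℝ) [IsProbabilityMeasure μ] {z : ℂ} (hz : 0 < z.im) :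
    cauchyG μ z ≠ 0 := fun h => by
  simpa [h] using im_cauchyG_neg μ hz

theorem im_Ftr_pos (μ : Measure ℝ) [IsProbabilityMeasure μ] {z : ℂ} (hz : 0 < z.im) :
    0 < (Ftr μ z).im := by
  rw [Ftr, Complex.inv_im]
  exact div_pos (neg_pos.2 (im_cauchyG_neg μ hz)) (Complex.normSq_pos.2 (cauchyG_ne_zero μ hz))

theorem differentiableOn_Ftr (μ : Measure ℝ) [IsProbabilityMeasure μ] :
    DifferentiableOn ℂ (Ftr μ) UHP :=
  (differentiableOn_cauchyG μ).inv fun _ hz => cauchyG_ne_zero μ hz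

theorem differentiableOn_cauchyG_comp_Ftr (ρ μ : Measure ℝ) [IsFiniteMeasure ρ]
    [IsProbabilityMeasure μ] : DifferentiableOn ℂ (fun z => cauchyG ρ (Ftr μ z)) UHP :=
  (differentiableOn_cauchyG ρ).comp (differentiableOn_Ftr μ) fun _ hz => im_Ftr_pos μ hz

theorem eqOn_UHP_of_eqOn_tcone {f g : ℂ → ℂ} (hf : DifferentiableOn ℂ f UHP)
    (hg : DifferentiableOn ℂ g UHP) {α M : ℝ} (hα : 0 < α) (hM : 0 < M)
    (h : EqOn f g (tcone α M)) : EqOn f g UHP := by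
  have hopen : IsOpen (tcone α M) :=
    (isOpen_lt (continuous_abs.comp Complex.continuous_re)
      (continuous_const.mul Complex.continuous_im)).inter
      (isOpen_lt continuous_const Complex.continuous_im)
  have hmem : ((M + 1 : ℝ) : ℂ) * I ∈ tcone α M := by
    simp only [tcone, mem_ofPred_eq]
    simp
    positivity
  refine (hf.analyticOnNhd isOpen_UHP).eqOn_of_preconnected_of_eventuallyEq
    (hg.analyticOnNhd isOpen_UHP) convex_UHP.isPreconnected
    (z₀ := ((M + 1 : ℝ) : ℂ) * I) ?_ ?_
  · simp only [UHP, mem_ofPred_eq]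
    simp
    positivity
  · exact eventuallyEq_of_mem (hopen.mem_nhds hmem) h

theorem tendsto_mul_cauchyG {ι : Type*} {l : Filter ι} [l.IsCountablyGenerated]
    (μ : Measure ℝ) [IsFiniteMeasure μ] {W : ι → ℂ} {C : ℝ}
    (hW : Tendsto (fun i => ‖W i‖) l atTop) (hpos : ∀ᶠ i in l, 0 < (W i).im)
    (hC : ∀ᶠ i in l, ‖W i‖ ≤ C * (W i).im) :
    Tendsto (fun i => W i * cauchyG μ (W i)) l (𝓝 (μ.real univ : ℂ)) := by
  have h1 : (μ.real univ : ℂ) = ∫ _ : ℝ, (1 : ℂ) ∂μ := by simp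
  simp only [cauchyG, ← integral_const_mul]
  rw [h1]
  refine tendsto_integral_filter_of_dominated_convergence (fun _ => C)
    (Eventually.of_forall fun i => by fun_prop) ?_ (integrable_const C)
    (Eventually.of_forall fun x => ?_)
  · filter_upwards [hpos, hC] with i hi hCi
    refine Eventually.of_forall fun x => ?_
    have hd : 0 < ‖W i - (x : ℂ)‖ := norm_pos_iff.2 (sub_ofReal_ne_zero hi x)
    have hC0 : 0 ≤ C := nonneg_of_mul_nonneg_left ((norm_nonneg _).trans hCi) hi
    rw [norm_mul, norm_inv, ← div_eq_mul_inv, div_le_iff₀ hd]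
    exact hCi.trans (mul_le_mul_of_nonneg_left (im_le_norm_sub_ofReal _ x) hC0)
  · have h2 : Tendsto (fun i => (1 - (x : ℂ) * (W i)⁻¹)⁻¹) l (𝓝 1) := by
      have h3 : Tendsto (fun i => (W i)⁻¹) l (𝓝 0) :=
        tendsto_inv₀_cobounded.comp (tendsto_norm_atTop_iff_cobounded.1 hW)
      have h4 := ((h3.const_mul (x : ℂ)).const_sub 1).inv₀ (by simp)
      simpa using h4
    refine h2.congr' ?_
    filter_upwards [hpos] with i hi
    have hne : W i ≠ 0 := fun h => by simp [h] at hi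
    have hd := sub_ofReal_ne_zero hi x
    have : 1 - (x : ℂ) * (W i)⁻¹ = (W i - x) * (W i)⁻¹ := by field_simp
    rw [this, mul_inv, inv_inv, mul_comm]

theorem tendsto_iy_mul_cauchyG (μ : Measure ℝ) [IsFiniteMeasure μ] :
    Tendsto (fun y : ℝ => ((y : ℂ) * I) * cauchyG μ ((y : ℂ) * I)) atTop
      (𝓝 (μ.real univ : ℂ)) := by
  refine tendsto_mul_cauchyG μ (C := 1) ?_ ?_ ?_
  · simpa using tendsto_abs_atTop_atTop
  · filter_upwards [eventually_gt_atTop 0] with y hy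
    simpa using hy
  · filter_upwards [eventually_gt_atTop 0] with y hy
    simp [abs_of_pos hy]

theorem tendsto_iy_mul_cauchyG_comp_Ftr (ρ μ : Measure ℝ) [IsProbabilityMeasure ρ]
    [IsProbabilityMeasure μ] :
    Tendsto (fun y : ℝ => ((y : ℂ) * I) * cauchyG ρ (Ftr μ ((y : ℂ) * I))) atTop (𝓝 1) := by
  have hG : Tendsto (fun y : ℝ => ((y : ℂ) * I) * cauchyG μ ((y : ℂ) * I)) atTop (𝓝 1) := by
    simpa using tendsto_iy_mul_cauchyG μ
  have hF : Tendsto (fun y : ℝ => Ftr μ ((y : ℂ) * I) / ((y : ℂ) * I)) atTop (𝓝 1) := by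
    simpa [Ftr, div_eq_mul_inv, mul_comm] using hG.inv₀ one_ne_zero
  have him : ∀ᶠ y : ℝ in atTop, y / 2 ≤ (Ftr μ ((y : ℂ) * I)).im := by
    have h := (Complex.continuous_re.tendsto _).comp hF
    filter_upwards [h.eventually (lt_mem_nhds (show (1 / 2 : ℝ) < (1 : ℂ).re by norm_num)),
      eventually_gt_atTop 0] with y hy hy0
    have h1 : Ftr μ ((y : ℂ) * I) = (y : ℂ) * I * (Ftr μ ((y : ℂ) * I) / ((y : ℂ) * I)) := by
      rw [mul_div_cancel₀]
      simpa using hy0.ne'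
    rw [h1]
    simp only [Function.comp] at hy
    simp only [mul_im, mul_re, ofReal_re, ofReal_im, I_re, I_im]
    nlinarith
  have hnorm : ∀ᶠ y : ℝ in atTop, ‖Ftr μ ((y : ℂ) * I)‖ ≤ 2 * y := by
    filter_upwards [hF.norm.eventually (gt_mem_nhds (show ‖(1 : ℂ)‖ < 2 by norm_num)),
      eventually_gt_atTop 0] with y hy hy0
    rw [norm_div, div_lt_iff₀ (by simpa using hy0.ne')] at hy
    simpa [abs_of_pos hy0] using hy.le
  have hlim : Tendsto (fun y : ℝ => Ftr μ ((y : ℂ) * I) * cauchyG ρ (Ftr μ ((y : ℂ) * I)))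
      atTop (𝓝 1) := by
    have := tendsto_mul_cauchyG (l := atTop) ρ (W := fun y : ℝ => Ftr μ ((y : ℂ) * I)) (C := 4)
      ?_ ?_ ?_
    · simpa using this
    · refine tendsto_atTop_mono' _ ?_ (tendsto_id.atTop_div_const (two_pos : (0 : ℝ) < 2))
      filter_upwards [him] with y hy
      exact hy.trans ((le_abs_self _).trans (Complex.abs_im_le_norm _))
    · filter_upwards [him, eventually_gt_atTop 0] with y hy hy0
      linarith
    · filter_upwards [him, hnorm] with y hy hn
      linarith
  refine ((hF.inv₀ one_ne_zero).mul hlim).congr' ?_ |>.trans_eq (by simp)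
  filter_upwards [him, eventually_gt_atTop 0] with y hy hy0
  have hne : Ftr μ ((y : ℂ) * I) ≠ 0 := fun h => by
    rw [h] at hy
    simp at hy
    linarith
  rw [inv_div]
  field_simp

/-- **Herglotz representation**: a holomorphic function with nonnegative real part on the unit disc
has real part equal to the Poisson integral of a finite measure. -/
theorem exists_poisson_measure_of_re_nonneg {f : ℂ → ℂ} (hf : DifferentiableOn ℂ f (ball 0 1))
    (hre : ∀ w ∈ ball (0 : ℂ) 1, 0 ≤ (f w).re) :
    ∃ σ : Measure ℝ, IsFiniteMeasure σ ∧ ∀ w ∈ ball (0 : ℂ) 1,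
      (f w).re = ∫ θ, (1 - ‖w‖ ^ 2) / ‖circleMap 0 1 θ - w‖ ^ 2 ∂σ := by
  obtain ⟨r, -, hr, hrlim⟩ := exists_seq_strictMono_tendsto' (zero_lt_one' ℝ)
  have hmaps : ∀ n, ∀ w ∈ closedBall (0 : ℂ) 1, (r n : ℂ) * w ∈ ball (0 : ℂ) 1 := by
    intro n w hw
    rw [mem_closedBall_zero_iff] at hw
    rw [mem_ball_zero_iff, norm_mul, norm_real, Real.norm_eq_abs, abs_of_pos (hr n).1]
    exact (mul_le_of_le_one_right (hr n).1.le hw).trans_lt (hr n).2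
  have hcirc : ∀ θ, circleMap 0 1 θ ∈ closedBall (0 : ℂ) 1 := fun θ =>
    sphere_subset_closedBall (circleMap_mem_sphere 0 zero_le_one θ)
  let p : ℕ → ℝ → ℝ := fun n θ => (2 * Real.pi)⁻¹ * (f (r n * circleMap 0 1 θ)).re
  have hp0 : ∀ n θ, 0 ≤ p n θ := fun n θ =>
    mul_nonneg (by positivity) (hre _ (hmaps n _ (hcirc θ)))
  have hpc : ∀ n, Continuous (p n) := fun n => by
    refine continuous_const.mul (Complex.continuous_re.comp ?_)
    exact hf.continuousOn.comp_continuous (by fun_prop) fun θ => hmaps n _ (hcirc θ)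
  let ν : ℕ → Measure ℝ := fun n =>
    (volume.restrict (Ioc 0 (2 * Real.pi))).withDensity fun θ => ENNReal.ofReal (p n θ)
  have hfin : ∀ n, IsFiniteMeasure (ν n) := fun n =>
    isFiniteMeasure_withDensity_ofReal ((hpc n).integrableOn_Ioc).2
  have hint : ∀ n, ∀ w ∈ ball (0 : ℂ) 1,
      ∫ θ, (1 - ‖w‖ ^ 2) / ‖circleMap 0 1 θ - w‖ ^ 2 ∂(ν n) = (f (r n * w)).re := by
    intro n w hw
    have hd : DiffContOnCl ℂ (fun z => f (r n * z)) (ball (0 : ℂ) 1) := by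
      refine DifferentiableOn.diffContOnCl ?_
      rw [closure_ball _ one_ne_zero]
      exact hf.comp (by fun_prop) (hmaps n)
    have hP := congrArg Complex.re (hd.circleAverage_poissonKernel_smul' hw)
    rw [Real.circleAverage_def, intervalIntegral.integral_of_le Real.two_pi_pos.le] at hP
    have hne : ∀ θ, ‖circleMap 0 1 θ - w‖ ^ 2 ≠ 0 := fun θ h => by
      have h0 : circleMap 0 1 θ = w := by simpa [sub_eq_zero] using h
      rw [← h0] at hw
      simp at hw
    rw [integral_withDensity_eq_integral_toReal_smul (by fun_prop) (by simp), ← hP]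
    simp only [Complex.smul_re]
    have hre' := integral_re (𝕜 := ℂ) (μ := volume.restrict (Ioc 0 (2 * Real.pi))) (f := fun θ =>
      ((‖circleMap 0 1 θ - 0‖ ^ 2 - ‖w - 0‖ ^ 2) / ‖circleMap 0 1 θ - 0 - (w - 0)‖ ^ 2) •
        f (r n * circleMap 0 1 θ)) ?_
    · simp only [RCLike.re_to_complex, Complex.smul_re] at hre'
      rw [← hre', smul_eq_mul, ← integral_const_mul]
      congr 1
      ext θ
      rw [ENNReal.toReal_ofReal (hp0 n θ)]
      simp [p]
      ring
    · refine Continuous.integrableOn_Ioc 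
        (Continuous.smul (f := fun θ => (‖circleMap 0 1 θ - 0‖ ^ 2 - ‖w - 0‖ ^ 2) /
          ‖circleMap 0 1 θ - 0 - (w - 0)‖ ^ 2) ?_ ?_)
      · simp only [sub_zero]
        exact Continuous.div (by fun_prop) (by fun_prop) hne
      · exact hf.continuousOn.comp_continuous (by fun_prop) fun θ => hmaps n _ (hcirc θ)
  let σ : ℕ → FiniteMeasure ℝ := fun n => ⟨ν n, hfin n⟩
  have hmass : ∀ n, (ν n).real univ = (f 0).re := fun n => by
    simpa using hint n 0 (by simp)
  have hmem : ∀ n, σ n ∈ {μ : FiniteMeasure ℝ | μ.mass ≤ (f 0).re.toNNReal ∧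
      μ (Icc 0 (2 * Real.pi))ᶜ = 0} := by
    intro n
    constructor
    · rw [← NNReal.coe_le_coe, Real.coe_toNNReal _ (hre 0 (by simp)), ← hmass n]
      exact le_rfl
    · have : ν n (Icc 0 (2 * Real.pi))ᶜ = 0 := by
        refine withDensity_absolutelyContinuous _ _ ?_
        rw [Measure.restrict_apply measurableSet_Icc.compl]
        convert measure_empty (μ := (volume : Measure ℝ))
        ext x
        simp
        grind
      simp [σ, this]
  obtain ⟨σ', -, hσ'⟩ := (isCompact_setOfPred_finiteMeasure_le_of_isCompact (f 0).re.toNNReal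
    (isCompact_Icc (a := (0 : ℝ)) (b := 2 * Real.pi))).ultrafilter_le_nhds
      ((hyperfilter ℕ).map σ) (by
        rw [le_principal_iff]
        exact mem_map.2 (univ_mem' hmem))
  refine ⟨σ', inferInstance, fun w hw => ?_⟩
  have hne : ∀ θ, ‖circleMap 0 1 θ - w‖ ^ 2 ≠ 0 := fun θ h => by
    have h0 : circleMap 0 1 θ = w := by simpa [sub_eq_zero] using h
    rw [← h0] at hw
    simp at hw
  have hw1 : ‖w‖ < 1 := by simpa using hw
  let g : BoundedContinuousFunction ℝ ℝ := BoundedContinuousFunction.ofNormedAddCommGroup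
    (fun θ => (1 - ‖w‖ ^ 2) / ‖circleMap 0 1 θ - w‖ ^ 2)
    (Continuous.div (by fun_prop) (by fun_prop) hne) ((1 - ‖w‖ ^ 2) / (1 - ‖w‖) ^ 2) fun θ => by
      have h1 : 1 - ‖w‖ ≤ ‖circleMap 0 1 θ - w‖ := by
        simpa using norm_sub_norm_le (circleMap 0 1 θ) w
      have h2 : 0 ≤ 1 - ‖w‖ ^ 2 := by nlinarith [norm_nonneg w]
      rw [Real.norm_of_nonneg (by positivity)]
      have h3 : 0 < 1 - ‖w‖ := by linarith
      gcongr
  have hlim : Tendsto σ (hyperfilter ℕ) (𝓝 σ') := hσ'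
  have h1 := FiniteMeasure.tendsto_iff_forall_integral_tendsto.1 hlim g
  have h2 : Tendsto (fun n => (f (r n * w)).re) (hyperfilter ℕ) (𝓝 (f w).re) := by
    refine Tendsto.mono_left ?_ Nat.hyperfilter_le_atTop
    refine (Complex.continuous_re.tendsto _).comp ?_
    refine (hf.continuousOn.continuousAt (isOpen_ball.mem_nhds hw)).tendsto.comp ?_
    simpa using ((Complex.continuous_ofReal.tendsto _).comp hrlim).mul_const w
  refine tendsto_nhds_unique h2 (h1.congr fun n => ?_)
  exact hint n w hw

theorem cayley_poissonKernel_eq {z : ℂ} (hz : 0 < z.im) (θ : ℝ) :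
    (1 - ‖(z - I) / (z + I)‖ ^ 2) / ‖circleMap 0 1 θ - (z - I) / (z + I)‖ ^ 2 =
      z.im / ‖(Real.cos (θ / 2) : ℂ) + z * (Real.sin (θ / 2) : ℂ)‖ ^ 2 := by
  have hne : z + I ≠ 0 := fun h => by
    have := congrArg Complex.im h
    simp at this
    linarith
  have hn : 0 < ‖z + I‖ := norm_pos_iff.2 hne
  set c : ℝ := Real.cos (θ / 2) with hc
  set s : ℝ := Real.sin (θ / 2) with hs
  have hcs : (c : ℂ) ^ 2 + (s : ℂ) ^ 2 = 1 := by
    have := Real.cos_sq_add_sin_sq (θ / 2)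
    exact_mod_cast this
  have hζ : circleMap 0 1 θ = ((c : ℂ) + s * I) ^ 2 := by
    have h2 : (θ : ℂ) * I = (2 : ℕ) * (((θ / 2 : ℝ) : ℂ) * I) := by push_cast; ring
    rw [circleMap_zero, ofReal_one, one_mul, h2, Complex.exp_nat_mul, Complex.exp_mul_I, hc, hs,
      ofReal_cos, ofReal_sin]
  have hu : ‖(c : ℂ) + s * I‖ ^ 2 = 1 := by
    rw [← Complex.normSq_eq_norm_sq, Complex.normSq_add_mul_I]
    exact_mod_cast hcs
  have hdiff : circleMap 0 1 θ - (z - I) / (z + I) =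
      2 * I * ((c : ℂ) + s * I) * ((c : ℂ) + z * s) / (z + I) := by
    rw [hζ, eq_div_iff hne, sub_mul, div_mul_cancel₀ _ hne]
    linear_combination (z - I) * hcs + (s ^ 2 * I - z * s ^ 2) * I_sq
  have hw : 1 - ‖(z - I) / (z + I)‖ ^ 2 = 4 * z.im / ‖z + I‖ ^ 2 := by
    rw [norm_div, div_pow, eq_div_iff (by positivity), sub_mul, div_mul_cancel₀ _ (by positivity),
      one_mul, ← Complex.normSq_eq_norm_sq, ← Complex.normSq_eq_norm_sq, Complex.normSq_apply,
      Complex.normSq_apply]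
    simp
    ring
  rw [hw, hdiff, norm_div, norm_mul, norm_mul, norm_mul, div_pow, mul_pow, mul_pow, mul_pow, hu,
    div_div_div_cancel_right₀ (by positivity)]
  simp only [Complex.norm_ofNat, Complex.norm_I]
  rw [show (2 : ℝ) ^ 2 * 1 ^ 2 * 1 = 4 by norm_num, mul_div_mul_left _ _ (by norm_num)]

theorem exists_halfPlane_poisson_measure {H : ℂ → ℂ} (hH : DifferentiableOn ℂ H UHP)
    (him : ∀ z ∈ UHP, (H z).im ≤ 0) :
    ∃ σ : Measure ℝ, IsFiniteMeasure σ ∧ ∀ z ∈ UHP, (H z).im =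
      -∫ θ, z.im / ‖(Real.cos (θ / 2) : ℂ) + z * (Real.sin (θ / 2) : ℂ)‖ ^ 2 ∂σ := by
  have hne : ∀ w ∈ ball (0 : ℂ) 1, 1 - w ≠ 0 := by
    intro w hw h
    rw [← sub_eq_zero.1 h] at hw
    simp at hw
  have hmaps : ∀ w ∈ ball (0 : ℂ) 1, I * ((1 + w) / (1 - w)) ∈ UHP := by
    intro w hw
    have h1 : ‖w‖ < 1 := by simpa using hw
    have h2 : w.re * w.re + w.im * w.im < 1 := by
      rw [← Complex.normSq_apply, Complex.normSq_eq_norm_sq]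
      nlinarith [norm_nonneg w]
    have h3 := Complex.normSq_pos.2 (hne w hw)
    simp only [UHP, mem_ofPred_eq, I_mul_im, Complex.div_re, ← add_div]
    refine div_pos ?_ h3
    simp
    nlinarith
  have hf : DifferentiableOn ℂ (fun w => I * H (I * ((1 + w) / (1 - w)))) (ball 0 1) := by
    refine DifferentiableOn.const_mul (hH.comp (fun w hw => ?_) hmaps) I
    have := hne w hw
    fun_prop (disch := assumption)
  obtain ⟨σ, hσ, h⟩ := exists_poisson_measure_of_re_nonneg hf fun w hw => by
    simpa using him _ (hmaps w hw)
  refine ⟨σ, hσ, fun z hz => ?_⟩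
  have hz0 : 0 < z.im := hz
  have hne' : z + I ≠ 0 := fun h => by
    have := congrArg Complex.im h
    simp at this
    linarith
  have hw : (z - I) / (z + I) ∈ ball (0 : ℂ) 1 := by
    rw [mem_ball_zero_iff, norm_div, div_lt_one (norm_pos_iff.2 hne'),
      ← sq_lt_sq₀ (norm_nonneg _) (norm_nonneg _), ← Complex.normSq_eq_norm_sq,
      ← Complex.normSq_eq_norm_sq, Complex.normSq_apply, Complex.normSq_apply]
    simp
    nlinarith
  have hZ : I * ((1 + (z - I) / (z + I)) / (1 - (z - I) / (z + I))) = z := by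
    have h1 : 1 + (z - I) / (z + I) = 2 * z / (z + I) := by field_simp; ring
    have h2 : 1 - (z - I) / (z + I) = 2 * I / (z + I) := by field_simp; ring
    rw [h1, h2, div_div_div_cancel_right₀ hne']
    field_simp
  have := h _ hw
  simp only [hZ, I_mul_re, cayley_poissonKernel_eq hz0] at this
  linarith

theorem eq_const_of_im_eq_zero_on_UHP {D : ℂ → ℂ} (hD : DifferentiableOn ℂ D UHP)
    (him : ∀ z ∈ UHP, (D z).im = 0) : ∃ k : ℂ, ∀ z ∈ UHP, D z = k := by
  obtain ⟨k, hk⟩ := (hD.analyticOnNhd isOpen_UHP).eq_const_of_im_eq_const him isOpen_UHP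
    ⟨⟨I, by simp [UHP]⟩, convex_UHP.isPreconnected⟩
  exact ⟨k, hk⟩

theorem lintegral_inv_sin_sq_le_one {H : ℂ → ℂ} {σ : Measure ℝ} [IsFiniteMeasure σ]
    (hσ : ∀ z ∈ UHP, (H z).im =
      -∫ θ, z.im / ‖(Real.cos (θ / 2) : ℂ) + z * (Real.sin (θ / 2) : ℂ)‖ ^ 2 ∂σ)
    (hlim : Tendsto (fun y : ℝ => ((y : ℂ) * I) * H ((y : ℂ) * I)) atTop (𝓝 1)) :
    ∫⁻ θ, (ENNReal.ofReal (Real.sin (θ / 2) ^ 2))⁻¹ ∂σ ≤ 1 := by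
  let q : ℕ → ℝ → ℝ := fun n θ => Real.cos (θ / 2) ^ 2 / n ^ 2 + Real.sin (θ / 2) ^ 2
  have hq1 : ∀ n : ℕ, 1 ≤ n → ∀ θ, ((n : ℝ) ^ 2)⁻¹ ≤ q n θ := by
    intro n hn θ
    have hn' : (1 : ℝ) ≤ n ^ 2 := one_le_pow₀ (by exact_mod_cast hn)
    have h2 : ((n : ℝ) ^ 2)⁻¹ ≤ 1 := inv_le_one_of_one_le₀ hn'
    have h3 := Real.cos_sq_add_sin_sq (θ / 2)
    have h4 := mul_nonneg (sq_nonneg (Real.sin (θ / 2))) (sub_nonneg.2 h2)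
    simp only [q, div_eq_mul_inv (Real.cos (θ / 2) ^ 2)]
    linear_combination h4 - ((n : ℝ) ^ 2)⁻¹ * h3
  have hqc : ∀ n, Continuous (q n) := fun n => by fun_prop
  have hint : ∀ n : ℕ, 1 ≤ n → ∫⁻ θ, (ENNReal.ofReal (q n θ))⁻¹ ∂σ =
      ENNReal.ofReal (((((n : ℝ) : ℂ) * I) * H (((n : ℝ) : ℂ) * I)).re) := by
    intro n hn
    have hn0 : (0 : ℝ) < n := by exact_mod_cast hn
    have hqpos : ∀ θ, 0 < q n θ := fun θ => lt_of_lt_of_le (by positivity) (hq1 n hn θ)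
    have hmem : ((n : ℝ) : ℂ) * I ∈ UHP := by simpa [UHP] using hn0
    have hre : ((((n : ℝ) : ℂ) * I) * H (((n : ℝ) : ℂ) * I)).re = ∫ θ, (q n θ)⁻¹ ∂σ := by
      have : ((((n : ℝ) : ℂ) * I) * H (((n : ℝ) : ℂ) * I)).re =
          -(n * (H (((n : ℝ) : ℂ) * I)).im) := by
        simp [Complex.mul_re]
      rw [this, hσ _ hmem, mul_neg, neg_neg, ← integral_const_mul]
      congr 1
      ext θ
      have hnorm : ‖(Real.cos (θ / 2) : ℂ) + (((n : ℝ) : ℂ) * I) * (Real.sin (θ / 2) : ℂ)‖ ^ 2 =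
          n ^ 2 * q n θ := by
        rw [show (Real.cos (θ / 2) : ℂ) + (((n : ℝ) : ℂ) * I) * (Real.sin (θ / 2) : ℂ) =
          (Real.cos (θ / 2) : ℂ) + ((n * Real.sin (θ / 2) : ℝ) : ℂ) * I by push_cast; ring,
          ← Complex.normSq_eq_norm_sq, Complex.normSq_add_mul_I]
        simp only [q]
        field_simp
      have := (hqpos θ).ne'
      rw [hnorm]
      simp
      field_simp
    rw [hre, ofReal_integral_eq_lintegral_ofReal]
    · simp only [ENNReal.ofReal_inv_of_pos (hqpos _)]
    · refine Integrable.of_bound (C := (n : ℝ) ^ 2)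
        ((hqc n).inv₀ fun θ => (hqpos θ).ne').aestronglyMeasurable
        (Eventually.of_forall fun θ => ?_)
      rw [Real.norm_of_nonneg (inv_nonneg.2 (hqpos θ).le)]
      exact inv_le_of_inv_le₀ (by positivity) (hq1 n hn θ)
    · exact Eventually.of_forall fun θ => inv_nonneg.2 (hqpos θ).le
  have hpt : ∀ θ, (ENNReal.ofReal (Real.sin (θ / 2) ^ 2))⁻¹ =
      liminf (fun n : ℕ => (ENNReal.ofReal (q n θ))⁻¹) atTop := by
    intro θ
    refine (Tendsto.liminf_eq ?_).symm
    refine (continuous_inv.tendsto _).comp ((ENNReal.continuous_ofReal.tendsto _).comp ?_)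
    have h1 : Tendsto (fun n : ℕ => Real.cos (θ / 2) ^ 2 / (n : ℝ) ^ 2) atTop (𝓝 0) :=
      tendsto_const_nhds.div_atTop
        ((tendsto_pow_atTop two_ne_zero).comp tendsto_natCast_atTop_atTop)
    simpa [q] using h1.add_const (Real.sin (θ / 2) ^ 2)
  have hlim' : Tendsto (fun n : ℕ => ∫⁻ θ, (ENNReal.ofReal (q n θ))⁻¹ ∂σ) atTop (𝓝 1) := by
    have h1 := (ENNReal.continuous_ofReal.tendsto _).comp ((Complex.continuous_re.tendsto _).comp
      (hlim.comp (tendsto_natCast_atTop_atTop (R := ℝ))))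
    simp only [one_re, ENNReal.ofReal_one] at h1
    refine h1.congr' ?_
    filter_upwards [eventually_ge_atTop 1] with n hn
    rw [hint n hn]
    rfl
  calc ∫⁻ θ, (ENNReal.ofReal (Real.sin (θ / 2) ^ 2))⁻¹ ∂σ
      = ∫⁻ θ, liminf (fun n : ℕ => (ENNReal.ofReal (q n θ))⁻¹) atTop ∂σ := by simp only [hpt]
    _ ≤ liminf (fun n : ℕ => ∫⁻ θ, (ENNReal.ofReal (q n θ))⁻¹ ∂σ) atTop :=
        lintegral_liminf_le fun n => by fun_prop
    _ = 1 := hlim'.liminf_eq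

theorem exists_measure_im_cauchyG_eq {H : ℂ → ℂ} (hH : DifferentiableOn ℂ H UHP)
    (him : ∀ z ∈ UHP, (H z).im ≤ 0)
    (hlim : Tendsto (fun y : ℝ => ((y : ℂ) * I) * H ((y : ℂ) * I)) atTop (𝓝 1)) :
    ∃ m : Measure ℝ, IsFiniteMeasure m ∧ ∀ z ∈ UHP, (cauchyG m z).im = (H z).im := by
  obtain ⟨σ, hσfin, hσ⟩ := exists_halfPlane_poisson_measure hH him
  have hle := lintegral_inv_sin_sq_le_one hσ hlim
  let d : ℝ → ENNReal := fun θ => (ENNReal.ofReal (Real.sin (θ / 2) ^ 2))⁻¹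
  have hd : Measurable d := by fun_prop
  have hdfin : ∀ᵐ θ ∂σ, d θ < ⊤ := ae_lt_top hd (hle.trans_lt ENNReal.one_lt_top).ne
  let x : ℝ → ℝ := fun θ => -(Real.cos (θ / 2) / Real.sin (θ / 2))
  have hx : Measurable x := by fun_prop
  have hτ : IsFiniteMeasure (σ.withDensity d) :=
    isFiniteMeasure_withDensity (hle.trans_lt ENNReal.one_lt_top).ne
  refine ⟨(σ.withDensity d).map x, inferInstance, fun z hz => ?_⟩
  rw [im_cauchyG _ hz, hσ z hz, integral_map hx.aemeasurable
    (Measurable.aestronglyMeasurable (by fun_prop)),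
    integral_withDensity_eq_integral_toReal_smul hd hdfin]
  congr 1
  refine integral_congr_ae ?_
  filter_upwards [hdfin] with θ hθ
  have hs : Real.sin (θ / 2) ≠ 0 := fun h => by simp [d, h] at hθ
  have hs' : (Real.sin (θ / 2) : ℂ) ≠ 0 := by exact_mod_cast hs
  have h1 : (Real.cos (θ / 2) : ℂ) + z * (Real.sin (θ / 2) : ℂ) =
      (z - (x θ : ℂ)) * (Real.sin (θ / 2) : ℂ) := by
    simp only [x, ofReal_neg, ofReal_div]
    field_simp
    ring
  rw [h1, norm_mul, mul_pow, norm_real, Real.norm_eq_abs, sq_abs, smul_eq_mul]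
  simp only [d, ENNReal.toReal_inv, ENNReal.toReal_ofReal (sq_nonneg _)]
  rw [div_mul_eq_div_div_swap, div_eq_inv_mul (z.im / _)]
  have := norm_pos_iff.2 (sub_ofReal_ne_zero hz (x θ))
  field_simp

/-- **Nevanlinna characterization**: a holomorphic map `H` from the upper half-plane to the closed
lower one with `iy * H (iy) → 1` is the Cauchy transform of a probability measure. -/
theorem exists_probabilityMeasure_cauchyG_eq {H : ℂ → ℂ} (hH : DifferentiableOn ℂ H UHP)
    (him : ∀ z ∈ UHP, (H z).im ≤ 0)
    (hlim : Tendsto (fun y : ℝ => ((y : ℂ) * I) * H ((y : ℂ) * I)) atTop (𝓝 1)) :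
    ∃ m : Measure ℝ, IsProbabilityMeasure m ∧ ∀ z ∈ UHP, cauchyG m z = H z := by
  obtain ⟨m, hm, hmim⟩ := exists_measure_im_cauchyG_eq hH him hlim
  obtain ⟨k, hk⟩ := eq_const_of_im_eq_zero_on_UHP (D := fun z => H z - cauchyG m z)
    (hH.sub (differentiableOn_cauchyG m)) fun z hz => by simp [hmim z hz]
  have hmem : ∀ᶠ y : ℝ in atTop, (y : ℂ) * I ∈ UHP := by
    filter_upwards [eventually_gt_atTop 0] with y hy
    simpa [UHP] using hy
  have h1 : Tendsto (fun y : ℝ => ((y : ℂ) * I) * k) atTop (𝓝 (1 - (m.real univ : ℂ))) := by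
    refine (hlim.sub (tendsto_iy_mul_cauchyG m)).congr' ?_
    filter_upwards [hmem] with y hy
    rw [← hk _ hy, mul_sub]
  have h0 : Tendsto (fun y : ℝ => ((y : ℂ) * I)⁻¹) atTop (𝓝 0) := by
    refine tendsto_inv₀_cobounded.comp (tendsto_norm_atTop_iff_cobounded.1 ?_)
    simpa using tendsto_abs_atTop_atTop
  have hk0 : k = 0 := by
    have h2 : Tendsto (fun _ : ℝ => k) atTop (𝓝 (0 * (1 - (m.real univ : ℂ)))) := by
      refine (h0.mul h1).congr' ?_
      filter_upwards [eventually_ne_atTop 0] with y hy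
      have : (y : ℂ) * I ≠ 0 := by simpa using hy
      rw [inv_mul_cancel_left₀ this]
    simpa using tendsto_nhds_unique tendsto_const_nhds h2
  have hone : (1 : ℂ) - (m.real univ : ℂ) = 0 := by
    simp only [hk0, mul_zero] at h1
    exact (tendsto_nhds_unique tendsto_const_nhds h1).symm
  refine ⟨m, ⟨?_⟩, fun z hz => ?_⟩
  · have : m.real univ = 1 := by
      have := sub_eq_zero.1 hone
      exact_mod_cast this.symm
    rwa [Measure.real, ENNReal.toReal_eq_one_iff] at this
  · have := hk z hz
    rw [hk0] at this
    exact (sub_eq_zero.1 this).symm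

/-- For a two-state free convolution semigroup `{(tμ t, μ t)}` with relative
canonical triple `(tβ, tγ, tρ)`, `tγ > 0`, one has `tμ t = δ_{tβ·t} ⊎ Φ[tρ ▷ μ t]^{⊎ tγ·t}`:
explicitly `z − F_{tμ_t}(z) = tβ·t + tγ·t·G_{tρ}(F_{μ_t}(z))` on `ℂ⁺`, and there is a
probability measure `m = tρ ▷ μ t` (monotone convolution, `F_m = F_{tρ} ∘ F_{μ_t}`) with
`z − F_{tμ_t}(z) = tβ·t + tγ·t·G_m(z)`; in particular `J[tμ_t] = tρ ▷ μ_t` for `t > 0`. -/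
theorem stmt5
    (tβ tγ : ℝ) (htγ : 0 < tγ)
    (tρ : Measure ℝ) (htρ : IsProbabilityMeasure tρ)
    (μ tμ : ℝ → Measure ℝ)
    (hprob : ∀ t : ℝ, 0 ≤ t → IsProbabilityMeasure (μ t) ∧ IsProbabilityMeasure (tμ t))
    (φ1 : ℂ → ℂ) (hsemi : ∀ t : ℝ, 0 ≤ t → IsVT (μ t) (fun z => (t : ℂ) * φ1 z))
    (htriple : ∀ t : ℝ, 0 ≤ t → IsTwoStateVT (tμ t) (μ t)
      (fun z => ((tβ * t : ℝ) : ℂ) + ((tγ * t : ℝ) : ℂ) * cauchyG tρ z)) :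
    ∀ t : ℝ, 0 ≤ t →
      (∀ z ∈ UHP, z - Ftr (tμ t) z =
        ((tβ * t : ℝ) : ℂ) + ((tγ * t : ℝ) : ℂ) * cauchyG tρ (Ftr (μ t) z)) ∧
      ∃ m : Measure ℝ, IsProbabilityMeasure m ∧
        (∀ z ∈ UHP, Ftr m z = Ftr tρ (Ftr (μ t) z)) ∧
        (∀ z ∈ UHP, z - Ftr (tμ t) z =
          ((tβ * t : ℝ) : ℂ) + ((tγ * t : ℝ) : ℂ) * cauchyG m z) := by
  intro t ht
  obtain ⟨hμ, htμ⟩ := hprob t ht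
  obtain ⟨α, M, hα, hM, hVT⟩ := htriple t ht
  have hcomp := differentiableOn_cauchyG_comp_Ftr tρ (μ t)
  have hform : ∀ z ∈ UHP, z - Ftr (tμ t) z =
      ((tβ * t : ℝ) : ℂ) + ((tγ * t : ℝ) : ℂ) * cauchyG tρ (Ftr (μ t) z) :=
    eqOn_UHP_of_eqOn_tcone (differentiableOn_id.sub (differentiableOn_Ftr (tμ t)))
      ((hcomp.const_mul _).const_add _) hα hM fun z hz => sub_eq_of_eq_add (hVT z hz).symm
  obtain ⟨m, hm, hmG⟩ := exists_probabilityMeasure_cauchyG_eq hcomp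
    (fun z hz => (im_cauchyG_neg tρ (im_Ftr_pos (μ t) hz)).le)
    (tendsto_iy_mul_cauchyG_comp_Ftr tρ (μ t))
  refine ⟨hform, m, hm, fun z hz => ?_, fun z hz => ?_⟩
  · rw [Ftr, hmG z hz]
    rfl
  · rw [hmG z hz, hform z hz]
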